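/- There is no integer d and 10×10 integer matrix M with nonzero determinant such that M·G₀·Mᵀ equals the block-diagonal matrix diag(d) ⊕ (−C), where C is the block Cartan matrix of A₄ ⊕ A₁ ⊕ A₁ ⊕ A₁ ⊕ A₁ ⊕ A₁. Equivalently, no rank-10 lattice of the form ℤH ⊥ R with R the negative-definite root lattice A₄ + 5A₁ embeds as a finite-index sublattice of the even unimodular lattice U + E₈ of signature (1,9). (This is the lattice-theoretic content of the paper's exclusion of the root type A₄ + 5A₁, whose discriminant group has length 5.) -/

import Mathlib

open Matrix

/-- The Cartan matrix of the root lattice `Aₙ`: vertices `0, …, n-1` in a chain. -/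
def cartanA (n : ℕ) : Matrix (Fin n) (Fin n) ℤ :=
  Matrix.of fun i j =>
    if i = j then 2
    else if (i : ℕ) + 1 = (j : ℕ) ∨ (j : ℕ) + 1 = (i : ℕ) then -1
    else 0

/-- The Cartan matrix of the root lattice `Dₙ` (`n ≥ 4`): a chain `0 — 1 — ⋯ — (n-3)`
with the two extra vertices `n-2` and `n-1` both attached to the vertex `n-3`. -/
def cartanD (n : ℕ) : Matrix (Fin n) (Fin n) ℤ :=
  Matrix.of fun i j =>
    if i = j then 2
    else if ((((i : ℕ) + 1 = (j : ℕ) ∨ (j : ℕ) + 1 = (i : ℕ)) ∧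
          ¬ (((i : ℕ) = n - 2 ∧ (j : ℕ) = n - 1) ∨ ((j : ℕ) = n - 2 ∧ (i : ℕ) = n - 1))) ∨
        (((i : ℕ) = n - 3 ∧ (j : ℕ) = n - 1) ∨ ((j : ℕ) = n - 3 ∧ (i : ℕ) = n - 1))) then -1
    else 0

/-- The Cartan matrix of the root lattice `Eₙ` (`n = 6, 7, 8`): a chain `1 — 2 — ⋯ — (n-1)`
with the extra vertex `0` attached to the vertex `3`. -/
def cartanE (n : ℕ) : Matrix (Fin n) (Fin n) ℤ :=
  Matrix.of fun i j =>
    if i = j then 2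
    else if ((((i : ℕ) + 1 = (j : ℕ) ∨ (j : ℕ) + 1 = (i : ℕ)) ∧
          ¬ ((i : ℕ) = 0 ∨ (j : ℕ) = 0)) ∨
        (((i : ℕ) = 0 ∧ (j : ℕ) = 3) ∨ ((j : ℕ) = 0 ∧ (i : ℕ) = 3))) then -1
    else 0

/-- The block-diagonal sum `A ⊕ B` of two square integer matrices. -/
def blockSum {m n : ℕ} (A : Matrix (Fin m) (Fin m) ℤ) (B : Matrix (Fin n) (Fin n) ℤ) :
    Matrix (Fin (m + n)) (Fin (m + n)) ℤ :=
  Matrix.of fun i j =>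
    if hi : (i : ℕ) < m then
      if hj : (j : ℕ) < m then A ⟨i, hi⟩ ⟨j, hj⟩ else 0
    else
      if hj : (j : ℕ) < m then 0
      else B ⟨(i : ℕ) - m, by have := i.isLt; omega⟩ ⟨(j : ℕ) - m, by have := j.isLt; omega⟩

/-- The Gram matrix of the hyperbolic plane `U`. -/
def gramU : Matrix (Fin 2) (Fin 2) ℤ := !![0, 1; 1, 0]

/-- The Gram matrix `G₀` of the even unimodular lattice `U + E₈` of signature `(1,9)`. -/
def gramUE8 : Matrix (Fin 10) (Fin 10) ℤ := blockSum gramU (-(cartanE 8))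

/-- The lower right block of a block-diagonal sum. -/
lemma blockSum_submatrix_natAdd {m n : ℕ} (A : Matrix (Fin m) (Fin m) ℤ)
    (B : Matrix (Fin n) (Fin n) ℤ) :
    (blockSum A B).submatrix (Fin.natAdd m) (Fin.natAdd m) = B := by
  ext i j
  simp [blockSum]

/-- `U + E₈` is an even lattice: its Gram matrix takes even values. -/
lemma two_dvd_dotProduct_gramUE8_mulVec (z : Fin 10 → ℤ) : 2 ∣ z ⬝ᵥ gramUE8 *ᵥ z := by
  let S : Matrix (Fin 10) (Fin 10) ℤ :=
    Matrix.of fun i j => if i < j then gramUE8 i j else if i = j then gramUE8 i j / 2 else 0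
  have hS : gramUE8 = S + Sᵀ := by decide +kernel
  refine ⟨z ⬝ᵥ S *ᵥ z, ?_⟩
  rw [hS, add_mulVec, dotProduct_add, mulVec_transpose, dotProduct_comm z (z ᵥ* S),
    ← dotProduct_mulVec]
  ring

/-- The reduction modulo `2` of the unimodular matrix `gramUE8` is invertible. -/
lemma isUnit_det_gramUE8_map : IsUnit (gramUE8.map (Int.cast : ℤ → ZMod 2)).det := by
  let H : Matrix (Fin 10) (Fin 10) (ZMod 2) := !![
    0, 1, 0, 0, 0, 0, 0, 0, 0, 0;
    1, 0, 0, 0, 0, 0, 0, 0, 0, 0;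
    0, 0, 0, 1, 0, 1, 0, 1, 0, 1;
    0, 0, 1, 0, 1, 0, 0, 0, 0, 0;
    0, 0, 0, 1, 0, 0, 0, 0, 0, 0;
    0, 0, 1, 0, 0, 0, 0, 0, 0, 0;
    0, 0, 0, 0, 0, 0, 0, 1, 0, 1;
    0, 0, 1, 0, 0, 0, 1, 0, 0, 0;
    0, 0, 0, 0, 0, 0, 0, 0, 0, 1;
    0, 0, 1, 0, 0, 0, 1, 0, 1, 0]
  have hH : gramUE8.map (Int.cast : ℤ → ZMod 2) * H = 1 := by decide +kernel
  exact isUnit_det_of_right_inverse hH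

/-- The lift of a vector over `ZMod 2` to an integer vector with entries `0` and `1`. -/
def zeroOneLift {k : ℕ} (w : Fin k → ZMod 2) : Fin k → ℤ := fun i => ((w i).val : ℤ)

/-- A linear relation modulo `2` between vectors of `U + E₈` lifts to an integer combination
lying in twice the lattice; this constrains the Gram matrix of these vectors. -/
lemma dvd_of_transpose_map_mulVec_eq_zero {k : ℕ} (N : Matrix (Fin k) (Fin 10) ℤ)
    (w : Fin k → ZMod 2) (hw : (N.map (Int.cast : ℤ → ZMod 2))ᵀ *ᵥ w = 0) :
    (∀ j, 2 ∣ ((N * gramUE8 * Nᵀ) *ᵥ zeroOneLift w) j) ∧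
      8 ∣ zeroOneLift w ⬝ᵥ (N * gramUE8 * Nᵀ) *ᵥ zeroOneLift w := by
  have hdvd : ∀ j, (2 : ℤ) ∣ (Nᵀ *ᵥ zeroOneLift w) j := by
    intro j
    refine (ZMod.intCast_zmod_eq_zero_iff_dvd _ 2).mp ?_
    refine Eq.trans ?_ (congrFun hw j)
    simp [mulVec, dotProduct, zeroOneLift]
  choose z hz using hdvd
  have hx : Nᵀ *ᵥ zeroOneLift w = (2 : ℤ) • z := funext fun j => by simp [hz j]
  have hE : (N * gramUE8 * Nᵀ) *ᵥ zeroOneLift w = (2 : ℤ) • (N *ᵥ (gramUE8 *ᵥ z)) := by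
    rw [← mulVec_mulVec, hx, mulVec_smul, mulVec_mulVec]
  refine ⟨fun j => ⟨_, by rw [hE]; rfl⟩, ?_⟩
  obtain ⟨c, hc⟩ := two_dvd_dotProduct_gramUE8_mulVec z
  refine ⟨c, ?_⟩
  rw [hE, dotProduct_smul, dotProduct_mulVec, ← mulVec_transpose, hx, smul_dotProduct, hc]
  simp only [smul_eq_mul]
  ring

/-- A matrix over `ZMod 2` with at most one nonzero relation between its rows has corank at
most one. -/
lemma le_rank_add_one {k n : ℕ} (N : Matrix (Fin k) (Fin n) (ZMod 2))
    (h : ∀ v w, Nᵀ *ᵥ v = 0 → Nᵀ *ᵥ w = 0 → v ≠ 0 → w = 0 ∨ w = v) : k ≤ N.rank + 1 := by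
  have hker : Module.finrank (ZMod 2) (LinearMap.ker Nᵀ.mulVecLin) ≤ 1 := by
    by_cases h0 : ∃ v, Nᵀ *ᵥ v = 0 ∧ v ≠ 0
    · obtain ⟨v, hv, hv0⟩ := h0
      refine finrank_le_one (⟨v, hv⟩ : LinearMap.ker Nᵀ.mulVecLin) ?_
      rintro ⟨w, hw⟩
      rcases h v w hv hw hv0 with rfl | rfl
      · exact ⟨0, by ext; simp⟩
      · exact ⟨1, by simp⟩
    · push Not at h0
      refine finrank_le_one 0 ?_
      rintro ⟨w, hw⟩
      exact ⟨0, by ext1; simp [h0 w hw]⟩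
  have hsum := LinearMap.finrank_range_add_finrank_ker Nᵀ.mulVecLin
  rw [Module.finrank_fin_fun] at hsum
  have hrank : N.rank = Module.finrank (ZMod 2) (LinearMap.range Nᵀ.mulVecLin) :=
    (rank_transpose N).symm
  omega

/-- A binary code of length five whose weights are divisible by four has at most one nonzero
word. -/
lemma eq_zero_or_eq_of_four_dvd_weight : ∀ b c : Fin 5 → ZMod 2,
    4 ∣ ∑ i, (b i).val → 4 ∣ ∑ i, (c i).val → 4 ∣ ∑ i, (b i + c i).val →
      b ≠ 0 → c = 0 ∨ c = b := by
  decide +kernel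

/-- The Gram matrix of the negative definite root lattice `A₄ + 5A₁`. -/
def gramA45A1 : Matrix (Fin 9) (Fin 9) ℤ :=
  -(blockSum (cartanA 4) (blockSum (cartanA 1) (blockSum (cartanA 1)
      (blockSum (cartanA 1) (blockSum (cartanA 1) (cartanA 1))))))

/-- Half-sums of roots in an even overlattice of `A₄ + 5A₁` involve only the summands `A₁`, and
zero or four of them. -/
lemma head_eq_zero_and_four_dvd_weight : ∀ w : Fin 9 → ZMod 2,
    (∀ j, 2 ∣ (gramA45A1 *ᵥ zeroOneLift w) j) →
    8 ∣ zeroOneLift w ⬝ᵥ gramA45A1 *ᵥ zeroOneLift w →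
      (∀ i : Fin 4, w (Fin.castAdd 5 i) = 0) ∧ 4 ∣ ∑ i : Fin 5, (w (Fin.natAdd 4 i)).val := by
  decide +kernel

/-- The analogue for `5A₁`. -/
lemma four_dvd_weight : ∀ w : Fin 5 → ZMod 2,
    8 ∣ zeroOneLift w ⬝ᵥ (gramA45A1.submatrix (Fin.natAdd 4) (Fin.natAdd 4)) *ᵥ zeroOneLift w →
      4 ∣ ∑ i, (w i).val := by
  decide +kernel

/-- The lattice `A₄ + 5A₁` does not embed into `U + E₈`. -/
lemma mul_gramUE8_mul_transpose_ne_gramA45A1 (K : Matrix (Fin 9) (Fin 10) ℤ) :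
    K * gramUE8 * Kᵀ ≠ gramA45A1 := by
  intro hK
  set T : Matrix (Fin 5) (Fin 10) ℤ := K.submatrix (Fin.natAdd 4) id
  have hT : T * gramUE8 * Tᵀ = gramA45A1.submatrix (Fin.natAdd 4) (Fin.natAdd 4) := by
    rw [← hK]
    rfl
  have hrankT : 5 ≤ (T.map (Int.cast : ℤ → ZMod 2)).rank + 1 := by
    have hweight (w : Fin 5 → ZMod 2) (hw : (T.map (Int.cast : ℤ → ZMod 2))ᵀ *ᵥ w = 0) :
        4 ∣ ∑ i, (w i).val :=
      four_dvd_weight w (hT ▸ (dvd_of_transpose_map_mulVec_eq_zero T w hw).2)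
    refine le_rank_add_one _ fun v w hv hw hv0 => ?_
    exact eq_zero_or_eq_of_four_dvd_weight v w (hweight v hv) (hweight w hw)
      (hweight (v + w) (by rw [mulVec_add, hv, hw, add_zero])) hv0
  have hrankK : 9 ≤ (K.map (Int.cast : ℤ → ZMod 2)).rank + 1 := by
    have hrel (w : Fin 9 → ZMod 2) (hw : (K.map (Int.cast : ℤ → ZMod 2))ᵀ *ᵥ w = 0) :
        (∀ i : Fin 4, w (Fin.castAdd 5 i) = 0) ∧
          4 ∣ ∑ i : Fin 5, (w (Fin.natAdd 4 i)).val := by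
      have h := dvd_of_transpose_map_mulVec_eq_zero K w hw
      rw [hK] at h
      exact head_eq_zero_and_four_dvd_weight w h.1 h.2
    have hext (v w : Fin 9 → ZMod 2)
        (hhead : ∀ i : Fin 4, v (Fin.castAdd 5 i) = w (Fin.castAdd 5 i))
        (htail : ∀ i : Fin 5, v (Fin.natAdd 4 i) = w (Fin.natAdd 4 i)) : v = w :=
      funext fun i => Fin.addCases (m := 4) (n := 5) hhead htail i
    refine le_rank_add_one _ fun v w hv hw hv0 => ?_
    obtain ⟨hv1, hv2⟩ := hrel v hv
    obtain ⟨hw1, hw2⟩ := hrel w hw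
    obtain ⟨-, hvw⟩ := hrel (v + w) (by rw [mulVec_add, hv, hw, add_zero])
    refine (eq_zero_or_eq_of_four_dvd_weight (fun i => v (Fin.natAdd 4 i))
      (fun i => w (Fin.natAdd 4 i)) hv2 hw2 hvw ?_).imp ?_ ?_
    · exact fun h => hv0 (hext _ _ hv1 fun i => congrFun h i)
    · exact fun h => hext _ _ hw1 fun i => congrFun h i
    · exact fun h => hext _ _ (fun i => (hw1 i).trans (hv1 i).symm) fun i => congrFun h i
  have hzero : K.map (Int.cast : ℤ → ZMod 2) * gramUE8.map (Int.cast : ℤ → ZMod 2) *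
      (T.map (Int.cast : ℤ → ZMod 2))ᵀ = 0 := by
    have hcols : (gramA45A1.submatrix id (Fin.natAdd 4 : Fin 5 → Fin 9)).map
        (Int.cast : ℤ → ZMod 2) = 0 := by decide +kernel
    rw [← hcols, ← hK, ← transpose_map]
    have hsub : (K * gramUE8 * Kᵀ).submatrix id (Fin.natAdd 4 : Fin 5 → Fin 9) =
      K * gramUE8 * Tᵀ := rfl
    rw [hsub]
    simp only [← Int.coe_castRingHom, Matrix.map_mul]
  have hle := rank_add_rank_le_card_of_mul_eq_zero hzero
  rw [rank_mul_eq_left_of_isUnit_det _ _ isUnit_det_gramUE8_map, rank_transpose,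
    Fintype.card_fin] at hle
  omega

/-- The root type `A₄ + 5A₁` does not admit a finite-index embedding
`ℤH ⊥ (A₄ + 5A₁) ↪ U + E₈` for any value `d = H²`. -/
theorem no_finite_index_embedding_A4_5A1 :
    ¬ ∃ (d : ℤ) (M : Matrix (Fin 10) (Fin 10) ℤ),
      M.det ≠ 0 ∧
      M * gramUE8 * M.transpose =
        blockSum !![d]
          (-(blockSum (cartanA 4) (blockSum (cartanA 1) (blockSum (cartanA 1)
              (blockSum (cartanA 1) (blockSum (cartanA 1) (cartanA 1))))))) := by
  rintro ⟨d, M, -, hM⟩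
  refine mul_gramUE8_mul_transpose_ne_gramA45A1 (M.submatrix (Fin.natAdd 1) id) ?_
  calc _ = (M * gramUE8 * Mᵀ).submatrix (Fin.natAdd 1) (Fin.natAdd 1) := rfl
    _ = gramA45A1 := by
      rw [hM]
      exact blockSum_submatrix_natAdd _ _
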